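/- arXiv:2201.12908 — 3 statements merged into one kernel-verified Lean document; each statement's English description precedes it below -/
import Mathlib

section
/- For every partition λ of n, the set of partitions of n obtained from λ by first adding a square to its Young diagram and then removing a different square equals the set of partitions of n obtained from λ by first removing a square and then adding a different square. -/
namespace YoungDiagram

theorem card_sup_add_card_inf (l m : YoungDiagram) :
    (l ⊔ m).card + (l ⊓ m).card = l.card + m.card :=
  Finset.card_union_add_card_inter l.cells m.cells

theorem card_le_card_of_le {l m : YoungDiagram} (h : l ≤ m) : l.card ≤ m.card :=
  Finset.card_le_card (cells_subset_iff.2 h)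

theorem card_lt_card_of_lt {l m : YoungDiagram} (h : l < m) : l.card < m.card :=
  Finset.card_lt_card (cells_ssubset_iff.2 h)

theorem card_lt_card_sup_of_ne {l m : YoungDiagram} (hcard : m.card = l.card) (hne : m ≠ l) :
    l.card < (l ⊔ m).card := by
  refine card_lt_card_of_lt (left_lt_sup.2 fun hle => ?_)
  have := card_lt_card_of_lt (lt_of_le_of_ne hle hne)
  omega

end YoungDiagram

/-- for `λ ⊢ n`, the partitions of `n` obtained from `λ` by
first adding a square and then removing a different square coincide with the
partitions of `n` obtained from `λ` by first removing a square and then adding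
a different square. -/
theorem add_remove_eq_remove_add (n : ℕ) (l : YoungDiagram) (hl : l.card = n) :
    {ν : YoungDiagram | ν.card = n ∧ ν ≠ l ∧
        ∃ κ : YoungDiagram, l ≤ κ ∧ κ.card = n + 1 ∧ ν ≤ κ} =
    {ν : YoungDiagram | ν.card = n ∧ ν ≠ l ∧
        ∃ μ : YoungDiagram, μ ≤ l ∧ μ.card + 1 = n ∧ μ ≤ ν} := by
  ext ν
  refine and_congr_right fun hν => and_congr_right fun hne => ?_
  have hlt := YoungDiagram.card_lt_card_sup_of_ne (hν.trans hl.symm) hne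
  have hadd := YoungDiagram.card_sup_add_card_inf l ν
  constructor
  · rintro ⟨κ, hlκ, hκ, hνκ⟩
    have hle := YoungDiagram.card_le_card_of_le (sup_le hlκ hνκ)
    exact ⟨l ⊓ ν, inf_le_left, by omega, inf_le_right⟩
  · rintro ⟨μ, hμl, hμ, hμν⟩
    have hle := YoungDiagram.card_le_card_of_le (le_inf hμl hμν)
    exact ⟨l ⊔ ν, le_sup_left, by omega, le_sup_right⟩
end

section
/- Let λ be a partition of n with exactly m removable squares. Then (m+1)·f_λ + Σ_{ν ∈ Λ⁺⁻} f_ν = Σ_{μ ∈ Λ⁺} f_μ, where Λ⁺ is the set of partitions of n+1 obtained from λ by adding one square and Λ⁺⁻ is the set of partitions ν ≠ λ of n obtained from λ by adding one square and then removing a different square. -/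
/-- A standard Young tableau of shape `μ`, encoded as a function on cells
(`0` outside the diagram) which is a bijection from the cells of `μ` onto
`{1, …, μ.card}` and strictly increases along rows and along columns. -/
def IsSYT (μ : YoungDiagram) (T : ℕ × ℕ → ℕ) : Prop :=
  Set.BijOn T (μ.cells : Set (ℕ × ℕ)) (Set.Icc 1 μ.card) ∧
  (∀ i j1 j2 : ℕ, j1 < j2 → (i, j2) ∈ μ → T (i, j1) < T (i, j2)) ∧
  (∀ i1 i2 j : ℕ, i1 < i2 → (i2, j) ∈ μ → T (i1, j) < T (i2, j)) ∧
  (∀ c : ℕ × ℕ, c ∉ μ → T c = 0)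

/-- `f_μ`, the number of standard Young tableaux of shape `μ`. -/
noncomputable def sytCard (μ : YoungDiagram) : ℕ :=
  Nat.card {T : ℕ × ℕ → ℕ // IsSYT μ T}

/-- `c` is a removable square of the Young diagram `μ`. -/
def Removable (μ : YoungDiagram) (c : ℕ × ℕ) : Prop :=
  c ∈ μ ∧ ∃ ν : YoungDiagram, ν.cells = μ.cells.erase c

/-- `c` is an addible square of the Young diagram `μ`. -/
def Addible (μ : YoungDiagram) (c : ℕ × ℕ) : Prop :=
  c ∉ μ ∧ ∃ ν : YoungDiagram, ν.cells = insert c μ.cells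

open YoungDiagram

theorem YoungDiagram.finite_setOf_le (μ : YoungDiagram) : {ν : YoungDiagram | ν ≤ μ}.Finite := by
  refine Set.Finite.of_finite_image (f := YoungDiagram.cells)
    (μ.cells.powerset.finite_toSet.subset ?_) fun ν _ ν' _ h => YoungDiagram.ext h
  rintro _ ⟨ν, hν, rfl⟩
  simpa using hν

/-- The standard Young tableaux of a given shape form a finite set. -/
theorem finite_setOf_isSYT (μ : YoungDiagram) : {T : ℕ × ℕ → ℕ | IsSYT μ T}.Finite := by
  refine Set.Finite.of_finite_image
    (f := fun (T : ℕ × ℕ → ℕ) (c : μ.cells) => T c)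
    ((Set.Finite.pi' fun _ => Set.finite_Icc 1 μ.card).subset ?_) ?_
  · rintro _ ⟨T, hT, rfl⟩ c
    exact hT.1.mapsTo c.2
  · intro T hT T' hT' h
    funext c
    by_cases hc : c ∈ μ
    · exact congrFun h ⟨c, hc⟩
    · rw [hT.2.2.2 c hc, hT'.2.2.2 c hc]

theorem sytCard_eq_ncard (μ : YoungDiagram) :
    sytCard μ = {T : ℕ × ℕ → ℕ | IsSYT μ T}.ncard := rfl

theorem IsSYT.apply_le {μ : YoungDiagram} {T : ℕ × ℕ → ℕ} (hT : IsSYT μ T) (c : ℕ × ℕ) :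
    T c ≤ μ.card := by
  by_cases hc : c ∈ μ
  · exact (hT.1.mapsTo hc).2
  · simp [hT.2.2.2 c hc]

theorem IsSYT.one_le_apply {μ : YoungDiagram} {T : ℕ × ℕ → ℕ} (hT : IsSYT μ T) {c : ℕ × ℕ}
    (hc : c ∈ μ) : 1 ≤ T c := (hT.1.mapsTo hc).1

theorem IsSYT.le_of_le {μ : YoungDiagram} {T : ℕ × ℕ → ℕ} (hT : IsSYT μ T) {c d : ℕ × ℕ}
    (hcd : c ≤ d) (hd : d ∈ μ) : T c ≤ T d := by
  obtain ⟨i, j⟩ := c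
  obtain ⟨i', j'⟩ := d
  obtain ⟨hi, hj⟩ := Prod.mk_le_mk.1 hcd
  calc T (i, j) ≤ T (i, j') := by
        rcases hj.eq_or_lt with rfl | hj
        · rfl
        · exact (hT.2.1 i j j' hj (μ.up_left_mem hi le_rfl hd)).le
    _ ≤ T (i', j') := by
        rcases hi.eq_or_lt with rfl | hi
        · rfl
        · exact (hT.2.2.1 i i' j' hi hd).le

/-- Extend a filling of `ν` to `μ` by writing `k` into each square of `μ` outside `ν`. -/
def extendFilling (μ ν : YoungDiagram) (k : ℕ) (T : ℕ × ℕ → ℕ) (c : ℕ × ℕ) : ℕ :=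
  if c ∈ μ ∧ c ∉ ν then k else T c

theorem injOn_extendFilling (μ ν : YoungDiagram) (k : ℕ) :
    Set.InjOn (extendFilling μ ν k) {T | IsSYT ν T} := by
  intro T hT T' hT' h
  funext c
  by_cases hc : c ∈ ν
  · simpa [extendFilling, hc] using congrFun h c
  · rw [hT.2.2.2 c hc, hT'.2.2.2 c hc]

theorem YoungDiagram.exists_cells_eq_insert {μ ν : YoungDiagram} (h : ν ≤ μ)
    (hc : μ.card = ν.card + 1) : ∃ c, c ∉ ν ∧ μ.cells = insert c ν.cells := by
  obtain ⟨c, hcν, hc⟩ := Finset.covBy_iff_exists_insert.1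
    (Finset.covBy_iff_card_sdiff_eq_one.2 ⟨h, by
      exact (Finset.card_sdiff_of_subset h).trans (Nat.sub_eq_of_eq_add' hc)⟩)
  exact ⟨c, hcν, hc.symm⟩

theorem IsSYT.extendFilling {μ ν : YoungDiagram} {T : ℕ × ℕ → ℕ} (hT : IsSYT ν T) (h : ν ≤ μ)
    (hc : μ.card = ν.card + 1) : IsSYT μ (extendFilling μ ν (ν.card + 1) T) := by
  obtain ⟨c, hcν, hcell⟩ := exists_cells_eq_insert h hc
  have mem_iff (d) : d ∈ μ ↔ d = c ∨ d ∈ ν := by rw [← mem_cells, hcell]; simp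
  have ext_c : _root_.extendFilling μ ν (ν.card + 1) T c = ν.card + 1 := by
    simp [_root_.extendFilling, mem_iff, hcν]
  have ext_of_ne {d} (hd : d ≠ c) : _root_.extendFilling μ ν (ν.card + 1) T d = T d := by
    simp only [_root_.extendFilling, mem_iff]
    rw [if_neg]
    tauto
  have lt_of_lt {d e : ℕ × ℕ} (hde : d < e) (he : e ∈ μ) (hlt : e ∈ ν → T d < T e) :
      _root_.extendFilling μ ν (ν.card + 1) T d < _root_.extendFilling μ ν (ν.card + 1) T e := by
    rcases (mem_iff e).1 he with rfl | he
    · rw [ext_c, ext_of_ne hde.ne]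
      exact Nat.lt_succ_of_le (hT.apply_le d)
    · have hd : d ∈ ν := ν.isLowerSet hde.le he
      rw [ext_of_ne (by rintro rfl; exact hcν hd), ext_of_ne (by rintro rfl; exact hcν he)]
      exact hlt he
  refine ⟨?_, fun i j₁ j₂ hj hm => lt_of_lt (by simpa using hj) hm (hT.2.1 i j₁ j₂ hj),
    fun i₁ i₂ j hi hm => lt_of_lt (by simpa using hi) hm (hT.2.2.1 i₁ i₂ j hi), fun d hd => ?_⟩
  · rw [hcell, hc, Finset.coe_insert, ← Nat.succ_eq_add_one, ← Nat.succ_eq_succ,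
      ← Set.insert_Icc_right_eq_Icc_succ (by simp)]
    have bij := (hT.1.congr fun d hd => (ext_of_ne ?_).symm).insert
      (a := c) (by simp [ext_c])
    · rwa [ext_c] at bij
    · rintro rfl; exact hcν hd
  · rw [mem_iff] at hd
    push Not at hd
    rw [ext_of_ne hd.1, hT.2.2.2 d hd.2]

/-- The squares of a tableau `T` whose entry is at most `k`. -/
def IsSYT.shapeLE {μ : YoungDiagram} {T : ℕ × ℕ → ℕ} (hT : IsSYT μ T) (k : ℕ) :
    YoungDiagram where
  cells := μ.cells.filter (T · ≤ k)
  isLowerSet := by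
    intro d c hcd hd
    simp only [Finset.coe_filter, Set.mem_ofPred_eq, mem_cells] at hd ⊢
    exact ⟨μ.isLowerSet hcd hd.1, (hT.le_of_le hcd hd.1).trans hd.2⟩

theorem IsSYT.mem_shapeLE {μ : YoungDiagram} {T : ℕ × ℕ → ℕ} (hT : IsSYT μ T) {k : ℕ}
    {c : ℕ × ℕ} : c ∈ hT.shapeLE k ↔ c ∈ μ ∧ T c ≤ k := by
  rw [← mem_cells]; simp [shapeLE]

theorem IsSYT.bijOn_shapeLE {μ : YoungDiagram} {T : ℕ × ℕ → ℕ} (hT : IsSYT μ T) {k : ℕ}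
    (hk : k ≤ μ.card) : Set.BijOn T (hT.shapeLE k).cells (Set.Icc 1 k) := by
  refine ⟨fun c hc => ?_, hT.1.injOn.mono fun c hc => (hT.mem_shapeLE.1 hc).1, fun v hv => ?_⟩
  · obtain ⟨hc, hck⟩ := hT.mem_shapeLE.1 hc
    exact ⟨hT.one_le_apply hc, hck⟩
  · obtain ⟨c, hc, rfl⟩ := hT.1.surjOn ⟨hv.1, hv.2.trans hk⟩
    exact ⟨c, hT.mem_shapeLE.2 ⟨hc, hv.2⟩, rfl⟩

theorem IsSYT.card_shapeLE {μ : YoungDiagram} {T : ℕ × ℕ → ℕ} (hT : IsSYT μ T) {k : ℕ}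
    (hk : k ≤ μ.card) : (hT.shapeLE k).card = k := by
  have h := (hT.bijOn_shapeLE hk).ncard_eq
  rwa [Set.ncard_coe_finset, ← Finset.coe_Icc, Set.ncard_coe_finset, Nat.card_Icc,
    Nat.add_sub_cancel] at h

theorem IsSYT.restrict_shapeLE {μ : YoungDiagram} {T : ℕ × ℕ → ℕ} (hT : IsSYT μ T) {k : ℕ}
    (hk : k ≤ μ.card) : IsSYT (hT.shapeLE k) fun c => if T c ≤ k then T c else 0 := by
  have lt_of_lt {d e : ℕ × ℕ} (he : e ∈ hT.shapeLE k) (hlt : T d < T e) :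
      (if T d ≤ k then T d else 0) < if T e ≤ k then T e else 0 := by
    have := (hT.mem_shapeLE.1 he).2
    rwa [if_pos this, if_pos (hlt.le.trans this)]
  refine ⟨?_, fun i j₁ j₂ hj hm => lt_of_lt hm (hT.2.1 i j₁ j₂ hj (hT.mem_shapeLE.1 hm).1),
    fun i₁ i₂ j hi hm => lt_of_lt hm (hT.2.2.1 i₁ i₂ j hi (hT.mem_shapeLE.1 hm).1),
    fun c hc => ?_⟩
  · rw [hT.card_shapeLE hk]
    exact (hT.bijOn_shapeLE hk).congr fun c hc => (if_pos (hT.mem_shapeLE.1 hc).2).symm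
  · rw [hT.mem_shapeLE] at hc
    dsimp only
    split_ifs with h
    · exact hT.2.2.2 c fun hm => hc ⟨hm, h⟩
    · rfl

/-- The branching rule: deleting the largest entry of a tableau. -/
theorem sytCard_eq_finsum {n : ℕ} {μ : YoungDiagram} (hμ : μ.card = n + 1) :
    sytCard μ = ∑ᶠ ν ∈ {ν : YoungDiagram | ν ≤ μ ∧ ν.card = n}, sytCard ν := by
  set N := {ν : YoungDiagram | ν ≤ μ ∧ ν.card = n}
  have union_eq : {T | IsSYT μ T} = ⋃ ν ∈ N, extendFilling μ ν (n + 1) '' {T | IsSYT ν T} := by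
    ext T
    simp only [Set.mem_iUnion, Set.mem_image, Set.mem_ofPred_eq, exists_prop]
    constructor
    · intro hT
      have hn : n ≤ μ.card := by omega
      refine ⟨hT.shapeLE n, ⟨fun c hc => (hT.mem_shapeLE.1 hc).1, hT.card_shapeLE hn⟩, _,
        hT.restrict_shapeLE hn, ?_⟩
      funext c
      have h := hT.apply_le c
      have h₀ := hT.2.2.2 c
      simp only [extendFilling, hT.mem_shapeLE]
      grind
    · rintro ⟨ν, ⟨hle, rfl⟩, T, hT, rfl⟩
      exact hT.extendFilling hle hμ
  have mem_iff {ν} (hν : ν ∈ N) {T} (hT : IsSYT ν T) (c : ℕ × ℕ) :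
      c ∈ ν ↔ c ∈ μ ∧ extendFilling μ ν (n + 1) T c ≤ n := by
    have h := hT.apply_le c
    have := hν.2
    have := @hν.1 c
    simp only [extendFilling]
    grind
  have disj : N.PairwiseDisjoint fun ν => extendFilling μ ν (n + 1) '' {T | IsSYT ν T} := by
    intro ν hν ν' hν' hne
    refine Set.disjoint_left.2 ?_
    rintro _ ⟨T, hT, rfl⟩ ⟨T', hT', h⟩
    refine hne (SetLike.ext fun c => ?_)
    rw [mem_iff hν hT, mem_iff hν' hT', h]
  have finite_N : N.Finite := μ.finite_setOf_le.subset fun ν hν => hν.1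
  rw [sytCard_eq_ncard, union_eq, finite_N.ncard_biUnion
    (fun ν _ => (finite_setOf_isSYT ν).image _) disj]
  refine finsum_mem_congr rfl fun ν _ => ?_
  rw [(injOn_extendFilling μ ν _).ncard_image, sytCard_eq_ncard]

theorem removable_iff {μ : YoungDiagram} {i j : ℕ} :
    Removable μ (i, j) ↔ μ.rowLen (i + 1) < μ.rowLen i ∧ j = μ.rowLen i - 1 := by
  constructor
  · rintro ⟨hm, ν, hν⟩
    have mem_iff (d) : d ∈ ν ↔ d ≠ (i, j) ∧ d ∈ μ := by
      rw [← mem_cells, hν, Finset.mem_erase, mem_cells]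
    have hr : (i, j + 1) ∉ μ := fun h => by
      have := ν.up_left_mem le_rfl (Nat.le_succ j) ((mem_iff (i, j + 1)).2 ⟨by simp, h⟩)
      exact ((mem_iff _).1 this).1 rfl
    have hd : (i + 1, j) ∉ μ := fun h => by
      have := ν.up_left_mem (Nat.le_succ i) le_rfl ((mem_iff (i + 1, j)).2 ⟨by simp, h⟩)
      exact ((mem_iff _).1 this).1 rfl
    rw [mem_iff_lt_rowLen] at hm hr hd
    omega
  · rintro ⟨h, rfl⟩
    refine ⟨mem_iff_lt_rowLen.2 (by omega), ⟨μ.cells.erase (i, μ.rowLen i - 1), ?_⟩, rfl⟩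
    rintro ⟨a, b⟩ ⟨a', b'⟩ hle hm
    obtain ⟨ha, hb⟩ := Prod.mk_le_mk.1 hle
    simp only [Finset.coe_erase, Set.mem_sdiff, SetLike.mem_coe, mem_cells,
      Set.mem_singleton_iff, Prod.mk.injEq] at hm ⊢
    refine ⟨μ.up_left_mem ha hb hm.1, ?_⟩
    rintro ⟨rfl, rfl⟩
    have h₁ := mem_iff_lt_rowLen.1 hm.1
    rcases ha.eq_or_lt with rfl | ha
    · exact hm.2 ⟨rfl, by omega⟩
    · have := μ.rowLen_anti (a' + 1) a ha
      omega

theorem addible_iff {μ : YoungDiagram} {i j : ℕ} :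
    Addible μ (i, j) ↔ (∀ k, i = k + 1 → μ.rowLen i < μ.rowLen k) ∧ j = μ.rowLen i := by
  constructor
  · rintro ⟨hm, ν, hν⟩
    have mem_iff (d) : d ∈ ν ↔ d = (i, j) ∨ d ∈ μ := by
      rw [← mem_cells, hν, Finset.mem_insert, mem_cells]
    have hij : (i, j) ∈ ν := (mem_iff _).2 (Or.inl rfl)
    rw [mem_iff_lt_rowLen] at hm
    have hj : j = μ.rowLen i := by
      by_contra hne
      have := (mem_iff _).1 (ν.up_left_mem le_rfl (show μ.rowLen i ≤ j by omega) hij)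
      rw [mem_iff_lt_rowLen, Prod.mk.injEq] at this
      omega
    refine ⟨?_, hj⟩
    rintro k rfl
    have := (mem_iff _).1 (ν.up_left_mem (Nat.le_succ k) le_rfl hij)
    rw [mem_iff_lt_rowLen, Prod.mk.injEq] at this
    omega
  · rintro ⟨h, rfl⟩
    refine ⟨by simp [mem_iff_lt_rowLen], ⟨insert (i, μ.rowLen i) μ.cells, ?_⟩, rfl⟩
    rintro ⟨a, b⟩ ⟨a', b'⟩ hle hm
    obtain ⟨ha, hb⟩ := Prod.mk_le_mk.1 hle
    simp only [Finset.coe_insert, Set.mem_insert_iff, Finset.mem_coe, mem_cells,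
      Prod.mk.injEq] at hm ⊢
    rcases hm with ⟨rfl, rfl⟩ | hm
    · rcases ha.eq_or_lt with rfl | ha
      · rw [mem_iff_lt_rowLen]
        omega
      · obtain ⟨k, rfl⟩ := Nat.exists_eq_add_one_of_ne_zero (Nat.ne_zero_of_lt ha)
        have := h k rfl
        have := μ.rowLen_anti _ _ (Nat.le_of_lt_succ ha)
        rw [mem_iff_lt_rowLen]
        omega
    · exact Or.inr (μ.up_left_mem ha hb hm)

theorem finite_setOf_removable (μ : YoungDiagram) : {c | Removable μ c}.Finite :=
  μ.cells.finite_toSet.subset fun _ hc => hc.1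

theorem setOf_removable_eq_image (μ : YoungDiagram) : {c | Removable μ c} =
    (fun i => (i, μ.rowLen i - 1)) '' {i | μ.rowLen (i + 1) < μ.rowLen i} := by
  ext ⟨i, j⟩
  simp only [Set.mem_ofPred_eq, removable_iff, Set.mem_image, Prod.mk.injEq]
  grind

theorem setOf_addible_eq_image (μ : YoungDiagram) : {c | Addible μ c} =
    (fun i => (i, μ.rowLen i)) ''
      insert 0 (Nat.succ '' {i | μ.rowLen (i + 1) < μ.rowLen i}) := by
  ext ⟨i, j⟩
  simp only [Set.mem_ofPred_eq, addible_iff, Set.mem_image, Prod.mk.injEq, Set.mem_insert_iff]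
  cases i <;> grind

theorem finite_setOf_rowLen_lt (μ : YoungDiagram) :
    {i | μ.rowLen (i + 1) < μ.rowLen i}.Finite := by
  have h := finite_setOf_removable μ
  rw [setOf_removable_eq_image] at h
  exact h.of_finite_image fun i _ i' _ h => (Prod.ext_iff.1 h).1

theorem finite_setOf_addible (μ : YoungDiagram) : {c | Addible μ c}.Finite := by
  rw [setOf_addible_eq_image]
  exact (((finite_setOf_rowLen_lt μ).image _).insert _).image _

/-- A Young diagram has one more addible square than it has removable squares. -/
theorem ncard_addible (μ : YoungDiagram) :
    {c | Addible μ c}.ncard = {c | Removable μ c}.ncard + 1 := by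
  rw [setOf_addible_eq_image, setOf_removable_eq_image,
    Set.ncard_image_of_injective _ fun i i' h => (Prod.ext_iff.1 h).1,
    Set.ncard_image_of_injective _ fun i i' h => (Prod.ext_iff.1 h).1,
    Set.ncard_insert_of_notMem (by simp) ((finite_setOf_rowLen_lt μ).image _),
    Set.ncard_image_of_injective _ Nat.succ_injective]

theorem image_cells_covers (μ : YoungDiagram) :
    YoungDiagram.cells '' {κ | μ ≤ κ ∧ κ.card = μ.card + 1} =
      (fun c => insert c μ.cells) '' {c | Addible μ c} := by
  ext s
  constructor
  · rintro ⟨κ, ⟨hle, hcard⟩, rfl⟩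
    obtain ⟨c, hc, h⟩ := exists_cells_eq_insert hle hcard
    exact ⟨c, ⟨hc, κ, h⟩, h.symm⟩
  · rintro ⟨c, ⟨hc, κ, h⟩, rfl⟩
    refine ⟨κ, ⟨?_, ?_⟩, h⟩
    · rw [← cells_subset_iff, h]
      exact Finset.subset_insert _ _
    · rw [YoungDiagram.card, h, Finset.card_insert_of_notMem hc]

theorem YoungDiagram.cells_injective : Function.Injective YoungDiagram.cells :=
  fun _ _ => YoungDiagram.ext

theorem finite_covers (μ : YoungDiagram) : {κ | μ ≤ κ ∧ κ.card = μ.card + 1}.Finite := by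
  refine Set.Finite.of_finite_image ?_ cells_injective.injOn
  rw [image_cells_covers]
  exact (finite_setOf_addible μ).image _

theorem ncard_covers (μ : YoungDiagram) :
    {κ | μ ≤ κ ∧ κ.card = μ.card + 1}.ncard = {c | Addible μ c}.ncard := by
  rw [← Set.ncard_image_of_injective _ cells_injective, image_cells_covers,
    Set.InjOn.ncard_image]
  intro c hc c' _ h
  have : c ∈ insert c' μ.cells := by
    rw [← show insert c μ.cells = insert c' μ.cells from h]
    exact Finset.mem_insert_self c μ.cells
  exact (Finset.mem_insert.1 this).resolve_right hc.1

theorem YoungDiagram.eq_sup_of_le {n : ℕ} {μ ν κ : YoungDiagram} (hμ : μ.card = n)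
    (hν : ν.card = n) (hne : ν ≠ μ) (hμκ : μ ≤ κ) (hνκ : ν ≤ κ) (hκ : κ.card = n + 1) :
    κ = μ ⊔ ν := by
  refine (cells_injective (Finset.eq_of_subset_of_card_le (sup_le hμκ hνκ) ?_)).symm
  have hlt : μ.cells ⊂ (μ ⊔ ν).cells := by
    refine lt_of_le_of_ne (show μ ≤ μ ⊔ ν from le_sup_left) fun h => hne ?_
    refine cells_injective (Finset.eq_of_subset_of_card_le ?_ (hμ.trans hν.symm).le)
    rw [h]
    exact (le_sup_right : ν ≤ μ ⊔ ν)
  exact hκ.le.trans (hμ ▸ Finset.card_lt_card hlt)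

/-- if `λ ⊢ n` has exactly `m` removable squares, then
`(m+1)·f_λ + Σ_{ν ∈ Λ⁺⁻} f_ν = Σ_{μ ∈ Λ⁺} f_μ`. -/
theorem sum_downward_from_above (n m : ℕ) (l : YoungDiagram) (hl : l.card = n)
    (hm : {c : ℕ × ℕ | Removable l c}.ncard = m) :
    (m + 1) * sytCard l +
      ∑ᶠ ν ∈ {ν : YoungDiagram | ν.card = n ∧ ν ≠ l ∧
          ∃ κ : YoungDiagram, l ≤ κ ∧ κ.card = n + 1 ∧ ν ≤ κ}, sytCard ν =
    ∑ᶠ μ ∈ {μ : YoungDiagram | l ≤ μ ∧ μ.card = n + 1}, sytCard μ := by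
  subst hl hm
  set U := {μ : YoungDiagram | l ≤ μ ∧ μ.card = l.card + 1}
  let N (μ : YoungDiagram) := {ν : YoungDiagram | ν ≤ μ ∧ ν.card = l.card ∧ ν ≠ l}
  have finite_N (μ) : (N μ).Finite := μ.finite_setOf_le.subset fun ν hν => hν.1
  have finite_U : U.Finite := finite_covers l
  have union_eq : {ν : YoungDiagram | ν.card = l.card ∧ ν ≠ l ∧
      ∃ κ : YoungDiagram, l ≤ κ ∧ κ.card = l.card + 1 ∧ ν ≤ κ} = ⋃ μ ∈ U, N μ := by
    ext ν
    simp only [Set.mem_iUnion, Set.mem_ofPred_eq, exists_prop, U, N]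
    grind
  have disj : U.PairwiseDisjoint N := by
    intro κ hκ κ' hκ' hne
    refine Set.disjoint_left.2 fun ν hν hν' => hne ?_
    rw [eq_sup_of_le rfl hν.2.1 hν.2.2 hκ.1 hν.1 hκ.2,
      eq_sup_of_le rfl hν'.2.1 hν'.2.2 hκ'.1 hν'.1 hκ'.2]
  have branch : ∀ μ ∈ U, sytCard μ = sytCard l + ∑ᶠ ν ∈ N μ, sytCard ν := by
    intro μ hμ
    rw [sytCard_eq_finsum hμ.2, ← finsum_mem_insert _ (fun h => h.2.2 rfl) (finite_N μ)]
    congr! 3 with ν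
    have := hμ.1
    simp only [Set.mem_ofPred_eq, Set.mem_insert_iff, N]
    grind
  rw [union_eq, finsum_mem_biUnion disj finite_U fun μ _ => finite_N μ,
    finsum_mem_congr rfl branch, finsum_mem_add_distrib finite_U, ← ncard_addible,
    ← ncard_covers, ← finsum_one, finsum_mem_mul]
  simp only [one_mul, U]
end

section
/- For every partition λ of a positive integer n, the number f_λ of standard Young tableaux of shape λ satisfies the upward recursion (n+1)·f_λ = Σ_{μ} f_μ, where the sum runs over all partitions μ of n+1 whose Young diagram is obtained from the Young diagram of λ by adding one square. -/
/-- The Young diagrams with `n` cells form a finite set. -/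
theorem YoungDiagram.finite_card_eq (n : ℕ) : {m : YoungDiagram | m.card = n}.Finite := by
  refine Set.Finite.of_finite_image (f := YoungDiagram.cells) ?_
    fun _ _ _ _ h => YoungDiagram.ext h
  refine (Finset.finite_toSet (Finset.range n ×ˢ Finset.range n).powerset).subset ?_
  rintro _ ⟨m, rfl, rfl⟩
  simp only [Finset.coe_powerset, Set.mem_preimage, Set.mem_powerset_iff, Finset.coe_subset]
  rintro ⟨i, j⟩ hc
  rw [YoungDiagram.mem_cells] at hc
  have hi := YoungDiagram.mem_iff_lt_colLen.1 hc
  have hj := YoungDiagram.mem_iff_lt_rowLen.1 hc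
  rw [YoungDiagram.colLen_eq_card] at hi
  rw [YoungDiagram.rowLen_eq_card] at hj
  exact Finset.mem_product.2
    ⟨Finset.mem_range.2 (hi.trans_le (Finset.card_le_card (Finset.filter_subset _ _))),
      Finset.mem_range.2 (hj.trans_le (Finset.card_le_card (Finset.filter_subset _ _)))⟩

namespace YoungDiagram

instance : DecidableEq YoungDiagram := fun _ _ => decidable_of_iff _ YoungDiagram.ext_iff.symm

/-- The Young diagrams with `n` cells. -/
noncomputable def level (n : ℕ) : Finset YoungDiagram := (finite_card_eq n).toFinset

/-- The Young diagrams obtained from `l` by adding one cell. -/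
noncomputable def upCovers (l : YoungDiagram) : Finset YoungDiagram :=
  ((finite_card_eq (l.card + 1)).subset
    (fun _ h => h.2 : {m | l ≤ m ∧ m.card = l.card + 1} ⊆ _)).toFinset

/-- The Young diagrams obtained from `l` by removing one cell. -/
noncomputable def downCovers (l : YoungDiagram) : Finset YoungDiagram :=
  ((finite_card_eq (l.card - 1)).subset
    (fun _ h => Nat.eq_sub_of_add_eq h.2 : {m | m ≤ l ∧ m.card + 1 = l.card} ⊆ _)).toFinset

theorem mem_level {n : ℕ} {m : YoungDiagram} : m ∈ level n ↔ m.card = n := by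
  simp [level]

theorem mem_upCovers {l m : YoungDiagram} :
    m ∈ upCovers l ↔ l ≤ m ∧ m.card = l.card + 1 := by
  simp [upCovers]

theorem mem_downCovers {l m : YoungDiagram} :
    m ∈ downCovers l ↔ m ≤ l ∧ m.card + 1 = l.card := by
  simp [downCovers]

theorem mem_downCovers_iff_mem_upCovers {l m : YoungDiagram} :
    m ∈ downCovers l ↔ l ∈ upCovers m := by
  rw [mem_downCovers, mem_upCovers, eq_comm]

theorem mem_upCovers_iff_exists_insert {l m : YoungDiagram} :
    m ∈ upCovers l ↔ ∃ c ∉ l, m.cells = insert c l.cells := by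
  rw [mem_upCovers, ← cells_subset_iff, eq_comm (a := m.card), ← Finset.exists_eq_insert_iff]
  simp only [mem_cells, eq_comm]

theorem eq_of_le_of_card_le {l m : YoungDiagram} (h : l ≤ m) (hc : m.card ≤ l.card) : l = m :=
  YoungDiagram.ext (Finset.eq_of_subset_of_card_le h hc)

theorem upCovers_inter_upCovers {l v : YoungDiagram} (hv : v.card = l.card) (hne : v ≠ l) :
    upCovers l ∩ upCovers v = if (l ⊔ v).card = l.card + 1 then {l ⊔ v} else ∅ := by
  have key : ∀ m, m ∈ upCovers l ∩ upCovers v ↔ m = l ⊔ v ∧ (l ⊔ v).card = l.card + 1 := by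
    intro m
    rw [Finset.mem_inter, mem_upCovers, mem_upCovers]
    constructor
    · rintro ⟨⟨h1, h2⟩, h3, -⟩
      have hlt : l.card < (l ⊔ v).card := by
        by_contra! h
        have e := eq_of_le_of_card_le (le_sup_left : l ≤ l ⊔ v) h
        exact hne (eq_of_le_of_card_le (e ▸ le_sup_right : v ≤ l) hv.ge)
      have e := eq_of_le_of_card_le (sup_le h1 h3) (by omega)
      exact ⟨e.symm, by rw [e, h2]⟩
    · rintro ⟨rfl, h⟩
      exact ⟨⟨le_sup_left, h⟩, le_sup_right, by rw [h, hv]⟩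
  ext m
  rw [key]
  split_ifs with h <;> simp [h]

theorem downCovers_inter_downCovers {l v : YoungDiagram} (hv : v.card = l.card) (hne : v ≠ l) :
    downCovers l ∩ downCovers v = if (l ⊓ v).card + 1 = l.card then {l ⊓ v} else ∅ := by
  have key : ∀ m, m ∈ downCovers l ∩ downCovers v ↔ m = l ⊓ v ∧ (l ⊓ v).card + 1 = l.card := by
    intro m
    rw [Finset.mem_inter, mem_downCovers, mem_downCovers]
    constructor
    · rintro ⟨⟨h1, h2⟩, h3, -⟩
      have hlt : (l ⊓ v).card < l.card := by
        by_contra! h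
        have e := eq_of_le_of_card_le (inf_le_left : l ⊓ v ≤ l) h
        exact hne (eq_of_le_of_card_le (e ▸ inf_le_right : l ≤ v) hv.le).symm
      have e := eq_of_le_of_card_le (le_inf h1 h3) (by omega)
      exact ⟨e, by rw [← e, h2]⟩
    · rintro ⟨rfl, h⟩
      exact ⟨⟨inf_le_left, h⟩, inf_le_right, by rw [h, hv]⟩
  ext m
  rw [key]
  split_ifs with h <;> simp [h]

theorem card_upCovers_inter_of_ne {l v : YoungDiagram} (hv : v.card = l.card) (hne : v ≠ l) :
    (upCovers l ∩ upCovers v).card = (downCovers l ∩ downCovers v).card := by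
  have h : (l ⊔ v).card + (l ⊓ v).card = l.card + v.card :=
    Finset.card_union_add_card_inter l.cells v.cells
  rw [upCovers_inter_upCovers hv hne, downCovers_inter_downCovers hv hne]
  have : (l ⊔ v).card = l.card + 1 ↔ (l ⊓ v).card + 1 = l.card := by omega
  simp only [this]
  split_ifs <;> simp

/-- The rows whose last cell can be removed. -/
def removableRows (l : YoungDiagram) : Finset ℕ :=
  (Finset.range (l.colLen 0)).filter fun i => l.rowLen (i + 1) < l.rowLen i

/-- The rows which can be extended by a cell. -/
def addableRows (l : YoungDiagram) : Finset ℕ :=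
  insert 0 (l.removableRows.image Nat.succ)

theorem mem_removableRows {l : YoungDiagram} {i : ℕ} :
    i ∈ l.removableRows ↔ l.rowLen (i + 1) < l.rowLen i := by
  simp only [removableRows, Finset.mem_filter, Finset.mem_range, and_iff_right_iff_imp]
  intro h
  rw [← mem_iff_lt_colLen, mem_iff_lt_rowLen]
  omega

theorem mem_addableRows {l : YoungDiagram} {i : ℕ} :
    i ∈ l.addableRows ↔ ∀ k < i, l.rowLen i < l.rowLen k := by
  rcases i with _ | i
  · simp [addableRows]
  · simp only [addableRows, Finset.mem_insert, Finset.mem_image, mem_removableRows]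
    constructor
    · rintro (h | ⟨k, hk, e⟩) a ha
      · omega
      · obtain rfl : k = i := by omega
        exact hk.trans_le (l.rowLen_anti a k (by omega))
    · exact fun h => Or.inr ⟨i, h i (by omega), rfl⟩

theorem card_addableRows (l : YoungDiagram) :
    l.addableRows.card = l.removableRows.card + 1 := by
  rw [addableRows, Finset.card_insert_of_notMem (by simp),
    Finset.card_image_of_injective _ Nat.succ_injective]

/-- Extend an addable row by one cell. -/
def addCell (l : YoungDiagram) (i : ℕ) (hi : i ∈ l.addableRows) : YoungDiagram where
  cells := insert (i, l.rowLen i) l.cells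
  isLowerSet := by
    rintro ⟨a, b⟩ ⟨a', b'⟩ ⟨h1, h2⟩ h
    simp only [Finset.coe_insert, Set.mem_insert_iff, Prod.mk.injEq, Finset.mem_coe, mem_cells,
      mem_iff_lt_rowLen] at h h1 h2 ⊢
    have := l.rowLen_anti a' a h1
    rcases h with ⟨rfl, rfl⟩ | h
    · rcases h1.eq_or_lt with rfl | h1
      · omega
      · have := mem_addableRows.1 hi a' h1
        omega
    · omega

/-- Remove the last cell of a removable row. -/
def removeCell (l : YoungDiagram) (i : ℕ) (hi : i ∈ l.removableRows) : YoungDiagram where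
  cells := l.cells.erase (i, l.rowLen i - 1)
  isLowerSet := by
    rintro ⟨a, b⟩ ⟨a', b'⟩ ⟨h1, h2⟩ h
    simp only [Finset.coe_erase, Set.mem_sdiff, Set.mem_singleton_iff, Prod.mk.injEq,
      Finset.mem_coe, mem_cells, mem_iff_lt_rowLen] at h h1 h2 ⊢
    have hr := mem_removableRows.1 hi
    have := l.rowLen_anti a' a h1
    refine ⟨by omega, ?_⟩
    rintro ⟨rfl, rfl⟩
    rcases h1.eq_or_lt with rfl | h1
    · omega
    · have := l.rowLen_anti (a' + 1) a h1
      omega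

theorem card_upCovers_eq (l : YoungDiagram) : (upCovers l).card = l.addableRows.card := by
  symm
  have hni : ∀ i, (i, l.rowLen i) ∉ l.cells := fun i => by
    rw [mem_cells, mem_iff_lt_rowLen]; omega
  refine Finset.card_bij l.addCell ?_ ?_ ?_
  · exact fun i hi => mem_upCovers_iff_exists_insert.2 ⟨_, hni i, rfl⟩
  · intro i hi k hk h
    have h : insert (i, l.rowLen i) l.cells = insert (k, l.rowLen k) l.cells :=
      congrArg YoungDiagram.cells h
    exact congrArg Prod.fst ((Finset.insert_inj (hni i)).1 h)
  · intro m hm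
    obtain ⟨⟨i, j⟩, hc, h⟩ := mem_upCovers_iff_exists_insert.1 hm
    have hmem : ∀ x, x ∈ m ↔ x = (i, j) ∨ x ∈ l := fun x => by
      rw [← mem_cells, h, Finset.mem_insert, mem_cells]
    have hij : (i, j) ∈ m := (hmem _).2 (Or.inl rfl)
    have hlow : ∀ a b, a ≤ i → b ≤ j → (a, b) ≠ (i, j) → b < l.rowLen a := fun a b ha hb hne =>
      mem_iff_lt_rowLen.1 (((hmem _).1 (m.up_left_mem ha hb hij)).resolve_left hne)
    rw [mem_iff_lt_rowLen] at hc
    have hj : j = l.rowLen i := by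
      rcases j with _ | j
      · omega
      · have := hlow i j le_rfl (by omega) (by simp)
        omega
    subst hj
    refine ⟨i, mem_addableRows.2 fun k hk => hlow k _ hk.le le_rfl (by simp; omega), ?_⟩
    exact YoungDiagram.ext h.symm

theorem card_downCovers_eq (l : YoungDiagram) :
    (downCovers l).card = l.removableRows.card := by
  symm
  have hi : ∀ i ∈ l.removableRows, (i, l.rowLen i - 1) ∈ l.cells := fun i hi => by
    have := mem_removableRows.1 hi
    rw [mem_cells, mem_iff_lt_rowLen]; omega
  refine Finset.card_bij l.removeCell ?_ ?_ ?_
  · exact fun i h => mem_downCovers.2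
      ⟨cells_subset_iff.1 (Finset.erase_subset _ _), Finset.card_erase_add_one (hi i h)⟩
  · intro i h k hk e
    have e : l.cells.erase (i, l.rowLen i - 1) = l.cells.erase (k, l.rowLen k - 1) :=
      congrArg YoungDiagram.cells e
    exact congrArg Prod.fst (Finset.erase_injOn _ (hi i h) (hi k hk) e)
  · intro m hm
    obtain ⟨⟨i, j⟩, hc, h⟩ :=
      mem_upCovers_iff_exists_insert.1 (mem_downCovers_iff_mem_upCovers.1 hm)
    have hmem : ∀ x, x ∈ l ↔ x = (i, j) ∨ x ∈ m := fun x => by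
      rw [← mem_cells, h, Finset.mem_insert, mem_cells]
    have hij : j < l.rowLen i := mem_iff_lt_rowLen.1 ((hmem _).2 (Or.inl rfl))
    have hup : ∀ a b, i ≤ a → j ≤ b → (a, b) ≠ (i, j) → ¬ b < l.rowLen a := by
      intro a b ha hb hne hlt
      exact hc (m.up_left_mem ha hb
        (((hmem _).1 (mem_iff_lt_rowLen.2 hlt)).resolve_left hne))
    have h1 := hup i (j + 1) le_rfl (by omega) (by simp)
    have h2 := hup (i + 1) j (by omega) le_rfl (by simp)
    obtain rfl : j = l.rowLen i - 1 := by omega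
    refine ⟨i, mem_removableRows.2 (by omega), YoungDiagram.ext ?_⟩
    change l.cells.erase (i, l.rowLen i - 1) = m.cells
    conv_lhs => arg 1; rw [h]
    exact Finset.erase_insert hc

theorem card_upCovers (l : YoungDiagram) : (upCovers l).card = (downCovers l).card + 1 := by
  rw [card_upCovers_eq, card_downCovers_eq, card_addableRows]

theorem card_upCovers_inter {l v : YoungDiagram} (hv : v.card = l.card) :
    (upCovers l ∩ upCovers v).card =
      (downCovers l ∩ downCovers v).card + if v = l then 1 else 0 := by
  split_ifs with h
  · rw [h, Finset.inter_self, Finset.inter_self, card_upCovers]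
  · rw [card_upCovers_inter_of_ne hv h, add_zero]

end YoungDiagram

namespace IsSYT

variable {μ ν : YoungDiagram} {T : ℕ × ℕ → ℕ} {c : ℕ × ℕ}

theorem le_card (h : IsSYT μ T) (x : ℕ × ℕ) : T x ≤ μ.card := by
  by_cases hx : x ∈ μ
  · exact (h.1.mapsTo hx).2
  · rw [h.2.2.2 x hx]; exact Nat.zero_le _

theorem lt_of_lt (h : IsSYT μ T) {x y : ℕ × ℕ} (hxy : x < y) (hy : y ∈ μ) : T x < T y := by
  obtain ⟨a, b⟩ := x
  obtain ⟨a', b'⟩ := y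
  obtain ⟨h1, h2⟩ : a ≤ a' ∧ b ≤ b' := hxy.le
  rcases h1.eq_or_lt with rfl | h1
  · rcases h2.eq_or_lt with rfl | h2
    · exact absurd hxy (lt_irrefl _)
    · exact h.2.1 _ _ _ h2 hy
  · rcases h2.eq_or_lt with rfl | h2
    · exact h.2.2.1 _ _ _ h1 hy
    · exact (h.2.1 _ _ _ h2 (μ.up_left_mem h1.le le_rfl hy)).trans (h.2.2.1 _ _ _ h1 hy)

theorem of_lt (hb : Set.BijOn T (μ.cells : Set (ℕ × ℕ)) (Set.Icc 1 μ.card))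
    (hlt : ∀ x y, x < y → y ∈ μ → T x < T y) (h0 : ∀ x ∉ μ, T x = 0) : IsSYT μ T :=
  ⟨hb, fun _ _ _ h hm => hlt _ _ (Prod.mk_lt_mk_iff_right.2 h) hm,
    fun _ _ _ h hm => hlt _ _ (Prod.mk_lt_mk_iff_left.2 h) hm, h0⟩

/-- Placing the largest entry in a new cell extends a standard tableau. -/
theorem update_insert (h : IsSYT ν T) (hc : c ∉ ν) (hμ : μ.cells = insert c ν.cells) :
    IsSYT μ (Function.update T c μ.card) := by
  have hcard : μ.card = ν.card + 1 := by
    rw [YoungDiagram.card, hμ, Finset.card_insert_of_notMem hc]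
  have hmem : ∀ x, x ∈ μ ↔ x = c ∨ x ∈ ν := fun x => by
    rw [← YoungDiagram.mem_cells, hμ, Finset.mem_insert, YoungDiagram.mem_cells]
  refine of_lt ?_ ?_ ?_
  · have hb : Set.BijOn (Function.update T c μ.card) (ν.cells : Set (ℕ × ℕ))
        (Set.Icc 1 ν.card) :=
      h.1.congr fun x hx => (Function.update_of_ne (by rintro rfl; exact hc hx) _ _).symm
    have := hb.insert (a := c) (by simp [hcard])
    rw [Function.update_self] at this
    convert this using 1
    · rw [hμ, Finset.coe_insert]
    · ext x; simp only [Set.mem_Icc, Set.mem_insert_iff]; omega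
  · intro x y hxy hy
    rcases (hmem y).1 hy with rfl | hy
    · rw [Function.update_self, Function.update_of_ne hxy.ne]
      have := h.le_card x
      omega
    · have hx : x ∈ ν := ν.isLowerSet hxy.le hy
      rw [Function.update_of_ne (by rintro rfl; exact hc hx),
        Function.update_of_ne (by rintro rfl; exact hc hy)]
      exact h.lt_of_lt hxy hy
  · intro x hx
    rw [hmem, not_or] at hx
    rw [Function.update_of_ne hx.1, h.2.2.2 x hx.2]

/-- Removing the largest entry of a standard tableau leaves a standard tableau. -/
theorem exists_erase (h : IsSYT μ T) (hc : c ∈ μ) (hT : T c = μ.card) :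
    ∃ ν : YoungDiagram, c ∉ ν ∧ μ.cells = insert c ν.cells ∧ IsSYT ν (Function.update T c 0) := by
  have hmax : ∀ y ∈ μ, ¬ c < y := fun y hy hlt => by
    have h1 := h.lt_of_lt hlt hy
    have h2 := h.le_card y
    omega
  let ν : YoungDiagram := ⟨μ.cells.erase c, by
    intro y x hxy hy
    rw [Finset.mem_coe, Finset.mem_erase] at hy ⊢
    refine ⟨?_, μ.isLowerSet hxy hy.2⟩
    rintro rfl
    exact hmax y hy.2 (lt_of_le_of_ne hxy hy.1.symm)⟩
  have hmem : ∀ x, x ∈ ν ↔ x ≠ c ∧ x ∈ μ := fun x => Finset.mem_erase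
  have hν : ν.card + 1 = μ.card := Finset.card_erase_add_one hc
  refine ⟨ν, by simp [hmem], (Finset.insert_erase hc).symm, of_lt ?_ ?_ ?_⟩
  · have hb := h.1.sdiff_singleton hc
    have hb : Set.BijOn (Function.update T c 0) ((μ.cells : Set (ℕ × ℕ)) \ {c})
        (Set.Icc 1 μ.card \ {T c}) :=
      hb.congr fun x hx => (Function.update_of_ne hx.2 _ _).symm
    convert hb using 1
    · exact Finset.coe_erase _ _
    · ext x; simp only [Set.mem_Icc, Set.mem_sdiff, Set.mem_singleton_iff]; omega
  · intro x y hxy hy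
    have hx : x ∈ ν := ν.isLowerSet hxy.le hy
    rw [hmem] at hx hy
    rw [Function.update_of_ne hx.1, Function.update_of_ne hy.1]
    exact h.lt_of_lt hxy hy.2
  · intro x hx
    by_cases hxc : x = c
    · rw [hxc, Function.update_self]
    · rw [Function.update_of_ne hxc]
      exact h.2.2.2 x fun hm => hx ((hmem x).2 ⟨hxc, hm⟩)

instance finite (μ : YoungDiagram) : Finite {T : ℕ × ℕ → ℕ // IsSYT μ T} := by
  refine Finite.of_injective (β := μ.cells → Fin (μ.card + 1))
    (fun T x => ⟨T.1 x, Nat.lt_succ_of_le (T.2.le_card x)⟩) ?_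
  intro T T' h
  ext x
  by_cases hx : x ∈ μ
  · exact congrArg Fin.val (congrFun h ⟨x, hx⟩)
  · rw [T.2.2.2.2 x hx, T'.2.2.2.2 x hx]

end IsSYT

open YoungDiagram

theorem sytCard_eq_sum_downCovers {μ : YoungDiagram} (hμ : 0 < μ.card) :
    sytCard μ = ∑ ν ∈ downCovers μ, sytCard ν := by
  have hex : ∀ ν : downCovers μ, ∃ c ∉ ν.1, μ.cells = insert c ν.1.cells := fun ν =>
    mem_upCovers_iff_exists_insert.1 (mem_downCovers_iff_mem_upCovers.1 ν.2)
  choose c hc hins using hex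
  let F : (Σ ν : downCovers μ, {T : ℕ × ℕ → ℕ // IsSYT ν.1 T}) → {T : ℕ × ℕ → ℕ // IsSYT μ T} :=
    fun p => ⟨Function.update p.2.1 (c p.1) μ.card, p.2.2.update_insert (hc p.1) (hins p.1)⟩
  have hF : Function.Bijective F := by
    constructor
    · rintro ⟨ν, T, hT⟩ ⟨ν', T', hT'⟩ h
      have h : Function.update T (c ν) μ.card = Function.update T' (c ν') μ.card :=
        congrArg Subtype.val h
      have hcc : c ν = c ν' := by
        by_contra hne
        have e := congrFun h (c ν)
        rw [Function.update_self, Function.update_of_ne hne] at e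
        have h1 := hT'.le_card (c ν)
        have h2 := (mem_downCovers.1 ν'.2).2
        omega
      obtain rfl : ν = ν' := by
        refine Subtype.ext (YoungDiagram.ext ?_)
        rw [← Finset.erase_insert (hc ν), ← Finset.erase_insert (hc ν'), ← hins, ← hins, hcc]
      obtain rfl : T = T' := by
        ext x
        by_cases hx : x = c ν
        · rw [hx, hT.2.2.2 _ (hc ν), hT'.2.2.2 _ (hc ν)]
        · simpa [Function.update_of_ne hx] using congrFun h x
      rfl
    · rintro ⟨T, hT⟩
      obtain ⟨d, hd, hTd⟩ := hT.1.surjOn (Set.mem_Icc.2 ⟨hμ, le_rfl⟩)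
      obtain ⟨ν, hdν, hi, hS⟩ := hT.exists_erase hd hTd
      have hν : ν ∈ downCovers μ :=
        mem_downCovers_iff_mem_upCovers.2 (mem_upCovers_iff_exists_insert.2 ⟨d, hdν, hi⟩)
      refine ⟨⟨⟨ν, hν⟩, _, hS⟩, Subtype.ext ?_⟩
      have hcd : c ⟨ν, hν⟩ = d :=
        (Finset.insert_inj (hc ⟨ν, hν⟩)).1 ((hins ⟨ν, hν⟩).symm.trans hi)
      change Function.update (Function.update T d 0) (c ⟨ν, hν⟩) μ.card = T
      rw [hcd, Function.update_idem, ← hTd, Function.update_eq_self]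
  rw [sytCard, ← Nat.card_eq_of_bijective F hF, Nat.card_sigma,
    ← Finset.sum_coe_sort (downCovers μ) sytCard]
  rfl

theorem sum_upCovers_sytCard (l : YoungDiagram) :
    ∑ m ∈ upCovers l, sytCard m =
      sytCard l + ∑ k ∈ downCovers l, ∑ v ∈ upCovers k, sytCard v := by
  have h1 : ∑ m ∈ upCovers l, sytCard m =
      ∑ v ∈ level l.card, ∑ _m ∈ upCovers l ∩ upCovers v, sytCard v := by
    rw [Finset.sum_congr rfl fun m hm =>
      sytCard_eq_sum_downCovers (by rw [(mem_upCovers.1 hm).2]; omega)]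
    refine Finset.sum_comm' fun m v => ?_
    simp only [mem_downCovers_iff_mem_upCovers, Finset.mem_inter, mem_level, mem_upCovers]
    constructor
    · rintro ⟨⟨a, b⟩, c, d⟩
      exact ⟨⟨⟨a, b⟩, c, d⟩, by omega⟩
    · rintro ⟨h, -⟩
      exact h
  have h2 : ∑ k ∈ downCovers l, ∑ v ∈ upCovers k, sytCard v =
      ∑ v ∈ level l.card, ∑ _k ∈ downCovers l ∩ downCovers v, sytCard v := by
    refine Finset.sum_comm' fun k v => ?_
    simp only [← mem_downCovers_iff_mem_upCovers, Finset.mem_inter, mem_level, mem_downCovers]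
    constructor
    · rintro ⟨⟨a, b⟩, c, d⟩
      exact ⟨⟨⟨a, b⟩, c, d⟩, by omega⟩
    · rintro ⟨h, -⟩
      exact h
  have h3 : sytCard l = ∑ v ∈ level l.card, if v = l then sytCard v else 0 := by
    rw [Finset.sum_ite_eq' (level l.card) l sytCard, if_pos (mem_level.2 rfl)]
  rw [h1, h2, h3, ← Finset.sum_add_distrib]
  refine Finset.sum_congr rfl fun v hv => ?_
  rw [Finset.sum_const, Finset.sum_const, card_upCovers_inter (mem_level.1 hv)]
  split_ifs <;> simp [add_mul, add_comm]

theorem sum_upCovers_sytCard_eq (n : ℕ) (l : YoungDiagram) (hl : l.card = n) :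
    ∑ m ∈ upCovers l, sytCard m = (n + 1) * sytCard l := by
  induction n generalizing l with
  | zero =>
    rw [sum_upCovers_sytCard, Finset.sum_eq_zero (s := downCovers l), zero_add, one_mul, add_zero]
    intro k hk
    have := (mem_downCovers.1 hk).2
    omega
  | succ n ih =>
    rw [sum_upCovers_sytCard, Finset.sum_congr rfl fun k hk =>
      ih k (by have := (mem_downCovers.1 hk).2; omega), ← Finset.mul_sum,
      ← sytCard_eq_sum_downCovers (by omega)]
    ring

/-- upward recursion: for a partition `λ ⊢ n` with `n > 0`,
`(n+1)·f_λ = Σ_{μ} f_μ`, summed over all partitions `μ ⊢ n+1` obtained from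
`λ` by adding one square. -/
theorem upward_recursion (n : ℕ) (hn : 0 < n) (l : YoungDiagram) (hl : l.card = n) :
    (n + 1) * sytCard l =
      ∑ᶠ m ∈ {m : YoungDiagram | l ≤ m ∧ m.card = n + 1}, sytCard m := by
  have h : {m : YoungDiagram | l ≤ m ∧ m.card = n + 1} = (upCovers l : Set YoungDiagram) := by
    ext m
    rw [Finset.mem_coe, mem_upCovers, hl, Set.mem_ofPred_eq]
  rw [h, finsum_mem_coe_finset, sum_upCovers_sytCard_eq n l hl]
end
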